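/- Let C : ℝ^n → ℝ be convex, differentiable, and strictly convex, with convex conjugate C* differentiable at every point of ∇C(ℝ^n). Let O be an outcome space, ρ : O → ℝ^n with ρ(X) ∈ ∇C(ℝ^n) for all X, let H be any set, φ : ℝ^n → H a surjective map, and L : H × O → ℝ a function such that for all s, s' ∈ ℝ^n and X ∈ O, L(φ(s);X) − L(φ(s');X) = (s' − s)·ρ(X) − C(s') + C(s). Then L is divergence-based: there exist a map ψ : H → ∇C(ℝ^n) and a function f : O → ℝ such that L(w;X) = D_{C*}(ρ(X), ψ(w)) + f(X) for all w ∈ H and X ∈ O. -/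

import Mathlib

open scoped RealInnerProductSpace

section Conjugate

open Filter Topology

variable {E : Type*} [NormedAddCommGroup E] [InnerProductSpace ℝ E] [CompleteSpace E]
  {f : E → ℝ} {p s : E}

theorem ConvexOn.add_inner_le_of_hasGradientAt (hf : ConvexOn ℝ Set.univ f)
    (hp : HasGradientAt f p s) (x : E) : f s + ⟪p, x - s⟫ ≤ f x := by
  have hline : HasDerivAt (fun t : ℝ => AffineMap.lineMap s x t) (x - s) 0 :=
    AffineMap.hasDerivAt_lineMap
  have hderiv : HasDerivAt (f ∘ AffineMap.lineMap s x) ⟪p, x - s⟫ (0 : ℝ) := by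
    have hs : HasFDerivAt f (InnerProductSpace.toDual ℝ E p)
        (AffineMap.lineMap s x (0 : ℝ)) := by
      simpa using hp.hasFDerivAt
    simpa using hs.comp_hasDerivAt (0 : ℝ) hline
  have hconv : ConvexOn ℝ Set.univ (f ∘ AffineMap.lineMap (k := ℝ) s x) := by
    simpa using hf.comp_affineMap (AffineMap.lineMap (k := ℝ) s x)
  have h := hconv.le_slope_of_hasDerivAt (Set.mem_univ 0) (Set.mem_univ 1) one_pos hderiv
  simp [slope_def_field] at h
  linarith

theorem StrictConvexOn.add_inner_lt_of_hasGradientAt (hf : StrictConvexOn ℝ Set.univ f)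
    (hp : HasGradientAt f p s) {x : E} (hx : x ≠ s) : f s + ⟪p, x - s⟫ < f x := by
  have hmid := hf.2 (Set.mem_univ s) (Set.mem_univ x) hx.symm
    (one_half_pos (α := ℝ)) (one_half_pos (α := ℝ)) (add_halves 1)
  have hgrad := hf.convexOn.add_inner_le_of_hasGradientAt hp
    ((1 / 2 : ℝ) • s + (1 / 2 : ℝ) • x)
  have hsub : (1 / 2 : ℝ) • s + (1 / 2 : ℝ) • x - s = (1 / 2 : ℝ) • (x - s) := by
    module
  rw [hsub, real_inner_smul_right] at hgrad
  simp only [smul_eq_mul] at hmid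
  linarith

theorem StrictConvexOn.exists_linear_growth [FiniteDimensional ℝ E]
    (hf : StrictConvexOn ℝ Set.univ f) (hcont : Continuous f) (hp : HasGradientAt f p s) :
    ∃ ε > 0, ∀ x, ε * (‖x - s‖ - 1) ≤ f x - f s - ⟪p, x - s⟫ := by
  obtain ⟨ε, hε, hsphere⟩ := (isCompact_sphere s 1).exists_forall_le'
    (f := fun x => f x - f s - ⟪p, x - s⟫) (a := 0) (by fun_prop) (fun x hx => by
      have hne : x ≠ s := by
        rintro rfl
        simp at hx
      linarith [hf.add_inner_lt_of_hasGradientAt hp hne])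
  refine ⟨ε, hε, fun x => ?_⟩
  rcases le_total ‖x - s‖ 1 with hr | hr
  · have := hf.convexOn.add_inner_le_of_hasGradientAt hp x
    nlinarith
  · have hpos : 0 < ‖x - s‖ := one_pos.trans_le hr
    have hinv : ‖x - s‖⁻¹ ≤ 1 := inv_le_one_of_one_le₀ hr
    have hz := hsphere (s + ‖x - s‖⁻¹ • (x - s)) (by
      simp [norm_smul, hpos.ne'])
    have hc := hf.convexOn.2 (Set.mem_univ s) (Set.mem_univ x)
      (sub_nonneg.2 hinv) (inv_nonneg.2 hpos.le) (sub_add_cancel 1 _)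
    have hcomb : (1 - ‖x - s‖⁻¹) • s + ‖x - s‖⁻¹ • x = s + ‖x - s‖⁻¹ • (x - s) := by
      module
    rw [hcomb] at hc
    simp only [add_sub_cancel_left, real_inner_smul_right, smul_eq_mul] at hz hc
    have hle : ε ≤ ‖x - s‖⁻¹ * (f x - f s - ⟪p, x - s⟫) := by linarith
    rw [le_inv_mul_iff₀ hpos] at hle
    linarith

theorem ConvexOn.iSup_inner_sub_of_hasGradientAt (hf : ConvexOn ℝ Set.univ f)
    (hp : HasGradientAt f p s) : ⨆ x, (⟪p, x⟫ - f x) = ⟪p, s⟫ - f s := by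
  have hle (x : E) : ⟪p, x⟫ - f x ≤ ⟪p, s⟫ - f s := by
    have := hf.add_inner_le_of_hasGradientAt hp x
    rw [inner_sub_right] at this
    linarith
  exact le_antisymm (ciSup_le hle)
    (le_ciSup (f := fun x => ⟪p, x⟫ - f x) ⟨_, Set.forall_mem_range.2 hle⟩ s)

theorem StrictConvexOn.eventually_bddAbove_inner_sub [FiniteDimensional ℝ E]
    (hf : StrictConvexOn ℝ Set.univ f) (hcont : Continuous f) (hp : HasGradientAt f p s) :
    ∀ᶠ y in 𝓝 p, BddAbove (Set.range fun x => ⟪y, x⟫ - f x) := by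
  obtain ⟨ε, hε, hgrowth⟩ := hf.exists_linear_growth hcont hp
  filter_upwards [Metric.ball_mem_nhds p hε] with y hy
  rw [mem_ball_iff_norm] at hy
  refine ⟨⟪y, s⟫ - f s + ε, Set.forall_mem_range.2 fun x => ?_⟩
  have hinner : ⟪y - p, x - s⟫ ≤ ε * ‖x - s‖ :=
    (real_inner_le_norm _ _).trans (by gcongr)
  have hx := hgrowth x
  simp only [inner_sub_left, inner_sub_right] at hinner hx
  linarith

theorem StrictConvexOn.eq_of_hasGradientAt_conjugate [FiniteDimensional ℝ E]
    (hf : StrictConvexOn ℝ Set.univ f) (hcont : Continuous f) (hp : HasGradientAt f p s)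
    {t : E} (ht : HasGradientAt (fun y => ⨆ x, (⟪y, x⟫ - f x)) t p) : t = s := by
  have hmin : IsLocalMin (fun y => (⨆ x, (⟪y, x⟫ - f x)) - ⟪s, y⟫) p := by
    filter_upwards [hf.eventually_bddAbove_inner_sub hcont hp] with y hy
    have hs := le_ciSup hy s
    rw [hf.convexOn.iSup_inner_sub_of_hasGradientAt hp, real_inner_comm s p,
      real_inner_comm y s]
    linarith
  have hderiv := hmin.hasFDerivAt_eq_zero
    (ht.hasFDerivAt.sub (InnerProductSpace.toDual ℝ E s).hasFDerivAt)
  exact (InnerProductSpace.toDual ℝ E).injective (sub_eq_zero.1 hderiv)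

end Conjugate

/-- If an automated prediction market maker with cost function `C`
and payoff function `ρ` implements a generalized scoring rule `L : H × O → ℝ` (via a
surjection `φ`), then `L` is divergence-based: `L(w;X) = D_{C*}(ρ(X), ψ(w)) + f(X)`
for some `ψ : H → ∇C(ℝⁿ)` and `f : O → ℝ`. -/
theorem apmm_implemented_gsr_is_divergence_based
    {n : ℕ} {O : Type*} {H : Type*}
    (C : EuclideanSpace ℝ (Fin n) → ℝ)
    (hCconv : ConvexOn ℝ Set.univ C)
    (hCstrict : StrictConvexOn ℝ Set.univ C)
    (gradC : EuclideanSpace ℝ (Fin n) → EuclideanSpace ℝ (Fin n))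
    (hgradC : ∀ x, HasGradientAt C (gradC x) x)
    (Cstar : EuclideanSpace ℝ (Fin n) → ℝ)
    (hCstarDef : ∀ y, Cstar y = ⨆ x : EuclideanSpace ℝ (Fin n), (⟪y, x⟫ - C x))
    (gradCstar : EuclideanSpace ℝ (Fin n) → EuclideanSpace ℝ (Fin n))
    (hgradCstar : ∀ p ∈ Set.range gradC, HasGradientAt Cstar (gradCstar p) p)
    (ρ : O → EuclideanSpace ℝ (Fin n)) (hρ : ∀ X, ρ X ∈ Set.range gradC)
    (φ : EuclideanSpace ℝ (Fin n) → H) (hφ : Function.Surjective φ)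
    (L : H → O → ℝ)
    (hL : ∀ (s s' : EuclideanSpace ℝ (Fin n)) (X : O),
      L (φ s) X - L (φ s') X = ⟪s' - s, ρ X⟫ - C s' + C s) :
    ∃ (ψ : H → EuclideanSpace ℝ (Fin n)) (f : O → ℝ),
      (∀ w, ψ w ∈ Set.range gradC) ∧
      ∀ w X, L w X
        = (Cstar (ρ X) - Cstar (ψ w) - ⟪gradCstar (ψ w), ρ X - ψ w⟫) + f X := by
  have hcont : Continuous C :=
    continuous_iff_continuousAt.2 fun x => (hgradC x).continuousAt
  obtain rfl : Cstar = fun y => ⨆ x, (⟪y, x⟫ - C x) := funext hCstarDef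
  choose σ hσ using hφ
  refine ⟨fun w => gradC (σ w), fun X => L (φ 0) X - C 0 - ⨆ x, (⟪ρ X, x⟫ - C x),
    fun w => Set.mem_range_self _, fun w X => ?_⟩
  have hgrad : gradCstar (gradC (σ w)) = σ w :=
    hCstrict.eq_of_hasGradientAt_conjugate hcont (hgradC _)
      (hgradCstar _ (Set.mem_range_self _))
  have hw := hL (σ w) 0 X
  rw [hσ, zero_sub, inner_neg_left] at hw
  simp only [hgrad, hCconv.iSup_inner_sub_of_hasGradientAt (hgradC (σ w)), inner_sub_right,
    real_inner_comm (gradC (σ w)) (σ w)]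
  linarith
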